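/- arXiv:2004.05331 — 9 statements merged into one kernel-verified Lean document; each statement's English description precedes it below -/
import Mathlib

section
/- Let s be a positive integer, let R be an s×s complex Hermitian positive definite matrix, and let K be an arbitrary s×s complex matrix. Define B = (1/4)·[(I + K) R⁻¹ (I + K*) + (I − K) R (I − K*)], where I is the s×s identity matrix and K* the conjugate transpose of K. Then both B − (1/2)(I − K K*) and B + (1/2)(I − K K*) are positive semidefinite Hermitian matrices. -/
open Matrix ComplexOrder

/-- Completing the square with respect to an invertible Hermitian matrix. -/
theorem Matrix.sub_mul_mul_inv_mul_conjTranspose {n : Type*} [Fintype n] [DecidableEq n]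
    {R : Matrix n n ℂ} (hR : R.IsHermitian) (hdet : IsUnit R.det) (P Q : Matrix n n ℂ) :
    (P - Q * R) * R⁻¹ * (P - Q * R)ᴴ =
      P * R⁻¹ * Pᴴ + Q * R * Qᴴ - (P * Qᴴ + Q * Pᴴ) := by
  have h : (P - Q * R) * R⁻¹ = P * R⁻¹ - Q := by
    rw [sub_mul, Matrix.mul_assoc, mul_nonsing_inv R hdet, Matrix.mul_one]
  have h' : P * R⁻¹ * (R * Qᴴ) = P * Qᴴ := by
    rw [Matrix.mul_assoc, ← Matrix.mul_assoc R⁻¹, nonsing_inv_mul R hdet, Matrix.one_mul]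
  rw [h, conjTranspose_sub, conjTranspose_mul, hR.eq, sub_mul, mul_sub, mul_sub, h',
    ← Matrix.mul_assoc Q]
  abel

/-- For an `s × s` Hermitian positive definite complex matrix `R` and an arbitrary
    complex matrix `K`, with `B = (1/4)·[(I+K) R⁻¹ (I+K*) + (I−K) R (I−K*)]`,
    both `B − (1/2)(I − K K*)` and `B + (1/2)(I − K K*)` are positive
    semidefinite (Hermitian) matrices. -/
theorem noise_matrix_posSemidef (s : ℕ) (hs : 0 < s)
    (R K : Matrix (Fin s) (Fin s) ℂ) (hR : R.PosDef)
    (B : Matrix (Fin s) (Fin s) ℂ)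
    (hB : B = (1 / 4 : ℂ) •
      ((1 + K) * R⁻¹ * (1 + Kᴴ) + (1 - K) * R * (1 - Kᴴ))) :
    (B - (1 / 2 : ℂ) • (1 - K * Kᴴ)).PosSemidef ∧
      (B + (1 / 2 : ℂ) • (1 - K * Kᴴ)).PosSemidef := by
  have hdet : IsUnit R.det := hR.isUnit.map detMonoidHom
  have hpos (C : Matrix (Fin s) (Fin s) ℂ) : ((1 / 4 : ℂ) • (C * R⁻¹ * Cᴴ)).PosSemidef :=
    (hR.inv.posSemidef.mul_mul_conjTranspose_same C).smul (by norm_num [Complex.le_def])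
  have hcross : (1 + K) * (1 - Kᴴ) + (1 - K) * (1 + Kᴴ) = (2 : ℂ) • (1 - K * Kᴴ) := by
    rw [two_smul]
    noncomm_ring
  have hminus := sub_mul_mul_inv_mul_conjTranspose hR.isHermitian hdet (1 + K) (1 - K)
  have hplus := sub_mul_mul_inv_mul_conjTranspose hR.isHermitian hdet (1 + K) (-(1 - K))
  simp only [conjTranspose_neg, Matrix.neg_mul, Matrix.mul_neg, neg_neg, ← neg_add] at hplus
  simp only [conjTranspose_add, conjTranspose_sub, conjTranspose_one, hcross] at hminus hplus
  constructor
  · convert hpos (1 + K - (1 - K) * R) using 1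
    simp only [conjTranspose_add, conjTranspose_sub, conjTranspose_one] at hminus ⊢
    rw [hminus, hB]
    module
  · convert hpos (1 + K - -((1 - K) * R)) using 1
    simp only [conjTranspose_add, conjTranspose_sub, conjTranspose_neg, conjTranspose_one]
      at hplus ⊢
    rw [hplus, hB]
    module
end

section
/- Let s be a positive integer, let R be an s×s complex Hermitian positive definite matrix, and let u ∈ ℂ^s. Then the Lebesgue integral over ℂ^s (identified with ℝ^{2s}) satisfies ∫_{ℂ^s} exp( i·Im(z* u) − z* R z ) dz = π^s · (det R)⁻¹ · exp( −(1/4)·u* R⁻¹ u ), where z* u = ∑_j conj(z_j) u_j and z* R z = ∑_{j,k} conj(z_j) R_{jk} z_k. -/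
open Matrix ComplexOrder MeasureTheory

/-- Change of variables for an invertible complex linear substitution on `ι → ℂ`. -/
theorem integral_comp_complex_mulVec {ι E : Type*} [Fintype ι] [DecidableEq ι]
    [NormedAddCommGroup E] [NormedSpace ℝ E] {B : Matrix ι ι ℂ} (hB : B.det ≠ 0)
    (g : (ι → ℂ) → E) :
    ∫ z, g (B *ᵥ z) = (Complex.normSq B.det)⁻¹ • ∫ w, g w := by
  have hdet : LinearMap.det ((Matrix.toLin' B).restrictScalars ℝ) = Complex.normSq B.det := by
    rw [LinearMap.det_restrictScalars, LinearMap.det_toLin', Algebra.norm_complex_apply]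
  have hne : LinearMap.det ((Matrix.toLin' B).restrictScalars ℝ) ≠ 0 := by
    rw [hdet]
    exact (Complex.normSq_pos.mpr hB).ne'
  have hemb : MeasurableEmbedding ((Matrix.toLin' B).restrictScalars ℝ) :=
    (LinearMap.equivOfDetNeZero _ hne).toContinuousLinearEquiv.toHomeomorph.measurableEmbedding
  have hmap := Measure.map_linearMap_addHaar_eq_smul_addHaar
    (volume : Measure (ι → ℂ)) hne
  calc
    ∫ z, g (B *ᵥ z)
        = ∫ w, g w ∂(Measure.map ((Matrix.toLin' B).restrictScalars ℝ) volume) :=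
          (hemb.integral_map g).symm
    _ = (Complex.normSq B.det)⁻¹ • ∫ w, g w := by
      rw [hmap, integral_smul_measure, hdet,
        abs_of_nonneg (inv_nonneg.mpr (Complex.normSq_nonneg _)),
        ENNReal.toReal_ofReal (inv_nonneg.mpr (Complex.normSq_nonneg _))]

/-- The Fourier transform of the standard Gaussian on `ℂ`. -/
theorem integral_cexp_I_mul_im_sub_normSq (v : ℂ) :
    ∫ z : ℂ, Complex.exp (Complex.I * ((star z * v).im : ℂ) - star z * z) =
      Real.pi * Complex.exp (-(1 / 4 : ℂ) * (star v * v)) := by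
  have h := GaussianFourier.integral_cexp_neg_mul_sq_norm_add (b := 1) (by simp) Complex.I
    (-Complex.I * v)
  have hnorm (z : ℂ) : star z * z = (‖z‖ : ℂ) ^ 2 := Complex.conj_mul' z
  have hinner (z : ℂ) : (star z * v).im = inner ℝ (-Complex.I * v) z := by
    simp [Complex.inner]
    ring
  simp_rw [hnorm, hinner]
  convert h using 1
  · congr 1 with z
    ring_nf
  · simp [Complex.finrank_real_complex]
    ring_nf

/-- The Fourier transform of the standard Gaussian on `ι → ℂ`. -/
theorem integral_cexp_I_mul_im_dotProduct_sub {ι : Type*} [Fintype ι] (v : ι → ℂ) :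
    ∫ w : ι → ℂ, Complex.exp (Complex.I * ((star w ⬝ᵥ v).im : ℂ) - star w ⬝ᵥ w) =
      (Real.pi : ℂ) ^ Fintype.card ι * Complex.exp (-(1 / 4 : ℂ) * (star v ⬝ᵥ v)) := by
  simp_rw [dotProduct, Complex.im_sum, Complex.ofReal_sum, Finset.mul_sum,
    ← Finset.sum_sub_distrib, Complex.exp_sum, Pi.star_apply]
  rw [integral_fintype_prod_volume_eq_prod
    (f := fun i (z : ℂ) ↦ Complex.exp (Complex.I * ((star z * v i).im : ℂ) - star z * z))]
  simp_rw [integral_cexp_I_mul_im_sub_normSq, Finset.prod_mul_distrib, Finset.prod_const,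
    Finset.card_univ]

open scoped MatrixOrder Matrix.Norms.L2Operator in
/-- A positive definite matrix factors as `Bᴴ * B` with `B` invertible. -/
theorem Matrix.PosDef.exists_isUnit_eq_conjTranspose_mul_self {ι : Type*} [Fintype ι]
    [DecidableEq ι] {R : Matrix ι ι ℂ} (hR : R.PosDef) :
    ∃ B : Matrix ι ι ℂ, IsUnit B ∧ R = Bᴴ * B :=
  CStarAlgebra.isStrictlyPositive_iff_eq_star_mul_self.mp hR.isStrictlyPositive

/-- Complex Gaussian Fourier integral: for an `s × s` Hermitian positive definite
    complex matrix `R` and `u ∈ ℂ^s`,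
    `∫_{ℂ^s} exp(i·Im(z* u) − z* R z) dz = π^s (det R)⁻¹ exp(−(1/4) u* R⁻¹ u)`,
    the integral being over Lebesgue measure on `ℂ^s ≅ ℝ^{2s}`. -/
theorem complex_gaussian_fourier_integral (s : ℕ) (hs : 0 < s)
    (R : Matrix (Fin s) (Fin s) ℂ) (hR : R.PosDef) (u : Fin s → ℂ) :
    ∫ z : Fin s → ℂ,
        Complex.exp (Complex.I * ((star z ⬝ᵥ u).im : ℂ) - star z ⬝ᵥ R.mulVec z) =
      (Real.pi : ℂ) ^ s * R.det⁻¹ *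
        Complex.exp (-(1 / 4 : ℂ) * (star u ⬝ᵥ R⁻¹.mulVec u)) := by
  obtain ⟨B, hBu, rfl⟩ := hR.exists_isUnit_eq_conjTranspose_mul_self
  have hB : IsUnit B.det := (Matrix.isUnit_iff_isUnit_det B).mp hBu
  have hBH : IsUnit Bᴴ.det := by
    rw [Matrix.det_conjTranspose]
    exact hB.star
  set v := (Bᴴ)⁻¹ *ᵥ u with hv
  have hu : u = Bᴴ *ᵥ v := by
    rw [hv, Matrix.mulVec_mulVec, Matrix.mul_nonsing_inv _ hBH, Matrix.one_mulVec]
  have hlin (z : Fin s → ℂ) : star z ⬝ᵥ u = star (B *ᵥ z) ⬝ᵥ v := by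
    rw [hu, Matrix.star_mulVec, Matrix.dotProduct_mulVec]
  have hquad (z : Fin s → ℂ) : star z ⬝ᵥ (Bᴴ * B) *ᵥ z = star (B *ᵥ z) ⬝ᵥ (B *ᵥ z) := by
    rw [← Matrix.mulVec_mulVec, Matrix.star_mulVec, Matrix.dotProduct_mulVec]
  have hdual : star u ⬝ᵥ (Bᴴ * B)⁻¹ *ᵥ u = star v ⬝ᵥ v := by
    rw [Matrix.mul_inv_rev, ← Matrix.mulVec_mulVec, ← hv, hu, Matrix.star_mulVec,
      Matrix.conjTranspose_conjTranspose, ← Matrix.dotProduct_mulVec, Matrix.mulVec_mulVec,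
      Matrix.mul_nonsing_inv _ hB, Matrix.one_mulVec]
  have hdet : (Bᴴ * B).det = (Complex.normSq B.det : ℂ) := by
    rw [Matrix.det_mul, Matrix.det_conjTranspose]
    exact Complex.normSq_eq_conj_mul_self.symm
  simp_rw [hlin, hquad]
  rw [integral_comp_complex_mulVec hB.ne_zero
    (fun w ↦ Complex.exp (Complex.I * ((star w ⬝ᵥ v).im : ℂ) - star w ⬝ᵥ w)),
    integral_cexp_I_mul_im_dotProduct_sub, hdual, hdet, Fintype.card_fin, Complex.real_smul,
    Complex.ofReal_inv]
  ring
end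

section
/- Let s be a positive integer, let R be an s×s complex Hermitian positive definite matrix, let K be an arbitrary s×s complex matrix, and let w ∈ ℂ^s. Set B = (1/4)·[(I + K) R⁻¹ (I + K*) + (I − K) R (I − K*)]. Then det R · π^{−s} · ∫_{ℂ^s} exp( i·Im(z*(I + K*)w) − z* R z − Re(z* R (I + K*) w) − (1/2)·w* R w − (1/2)·w* (K R K*) w ) dz = exp( −w* B w ), where the integral is with respect to Lebesgue measure on ℂ^s ≅ ℝ^{2s} and x* M y = ∑_{j,k} conj(x_j) M_{jk} y_k. -/
open Matrix ComplexOrder MeasureTheory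

/-- Complex Gaussian integral in one variable, with independent linear terms in `z` and its conjugate. -/
theorem integral_cexp_neg_conj_mul_self_add (a c : ℂ) :
    ∫ z : ℂ, Complex.exp (-(star z * z) + star z * a + c * z) = Real.pi * Complex.exp (c * a) := by
  have hb : (-1 : ℂ).re < 0 := by simp
  have h (y : ℝ × ℝ) :
      Complex.exp (-(star (Complex.measurableEquivRealProd.symm y) *
        Complex.measurableEquivRealProd.symm y) +
        star (Complex.measurableEquivRealProd.symm y) * a +
        c * Complex.measurableEquivRealProd.symm y) =
      Complex.exp (-1 * (y.1 : ℂ) ^ 2 + (a + c) * y.1 + 0) *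
        Complex.exp (-1 * (y.2 : ℂ) ^ 2 + Complex.I * (c - a) * y.2 + 0) := by
    rw [← Complex.exp_add, Complex.measurableEquivRealProd_symm_apply, Complex.mk_eq_add_mul_I]
    simp only [star_add, star_mul', RCLike.star_def, Complex.conj_ofReal, Complex.conj_I]
    congr 1
    linear_combination (y.2 : ℂ) ^ 2 * Complex.I_sq
  rw [← Complex.volume_preserving_equiv_real_prod.symm.integral_comp
    Complex.measurableEquivRealProd.symm.measurableEmbedding]
  simp_rw [h]
  rw [Measure.volume_eq_prod, integral_prod_mul
    (fun x : ℝ => Complex.exp (-1 * (x : ℂ) ^ 2 + (a + c) * x + 0))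
    (fun x : ℝ => Complex.exp (-1 * (x : ℂ) ^ 2 + Complex.I * (c - a) * x + 0)),
    integral_cexp_quadratic hb, integral_cexp_quadratic hb, mul_mul_mul_comm, ← Complex.exp_add]
  congr 1
  · rw [neg_neg, div_one, ← Complex.cpow_add _ _ (by simp [Real.pi_ne_zero])]
    norm_num
  · congr 1
    linear_combination (c - a) ^ 2 / 4 * Complex.I_sq

/-- Change of variables in `ℂ^s` by an invertible complex matrix: the real Jacobian is `|det M|²`. -/
theorem integral_comp_mulVec {s : ℕ} (M : Matrix (Fin s) (Fin s) ℂ) (hM : IsUnit M)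
    (f : (Fin s → ℂ) → ℂ) :
    M.det * star M.det * ∫ z, f (M.mulVec z) = ∫ z, f z := by
  let L : (Fin s → ℂ) →L[ℝ] (Fin s → ℂ) :=
    LinearMap.toContinuousLinearMap (M.mulVecLin.restrictScalars ℝ)
  have hdet : ((|L.det| : ℝ) : ℂ) = M.det * star M.det := by
    have : L.det = Complex.normSq M.det := by
      simp [L, ContinuousLinearMap.det, LinearMap.det_restrictScalars, Algebra.norm_complex_eq,
        ← Matrix.toLin'_apply']
    rw [this, abs_of_nonneg (Complex.normSq_nonneg _), RCLike.star_def, Complex.mul_conj]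
  have hbij : Function.Bijective L := by
    exact ⟨mulVec_injective_iff_isUnit.2 hM, mulVec_surjective_iff_isUnit.2 hM⟩
  have := integral_image_eq_integral_abs_det_fderiv_smul volume MeasurableSet.univ
    (fun x _ => L.hasFDerivAt.hasFDerivWithinAt) hbij.1.injOn f
  rw [Set.image_univ, hbij.2.range_eq, setIntegral_univ, setIntegral_univ, integral_smul] at this
  rw [this, Complex.real_smul, hdet]
  rfl

/-- Standard complex Gaussian integral over `ℂ^s` with linear terms. -/
theorem integral_cexp_neg_star_dotProduct_self_add {s : ℕ} (a c : Fin s → ℂ) :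
    ∫ z : Fin s → ℂ, Complex.exp (-(star z ⬝ᵥ z) + star z ⬝ᵥ a + c ⬝ᵥ z) =
      (Real.pi : ℂ) ^ s * Complex.exp (c ⬝ᵥ a) := by
  have h (z : Fin s → ℂ) : Complex.exp (-(star z ⬝ᵥ z) + star z ⬝ᵥ a + c ⬝ᵥ z) =
      ∏ i, Complex.exp (-(star (z i) * z i) + star (z i) * a i + c i * z i) := by
    simp only [← Complex.exp_sum, Finset.sum_add_distrib, Finset.sum_neg_distrib, dotProduct,
      Pi.star_apply]
  simp_rw [h]
  rw [integral_fintype_prod_volume_eq_prod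
    (fun i (x : ℂ) => Complex.exp (-(star x * x) + star x * a i + c i * x))]
  simp_rw [integral_cexp_neg_conj_mul_self_add]
  rw [Finset.prod_mul_distrib, ← Complex.exp_sum]
  simp [dotProduct]

open scoped MatrixOrder in
/-- Complex Gaussian integral with positive definite quadratic form `R` and linear terms. -/
theorem Matrix.PosDef.det_mul_integral_cexp {s : ℕ} {R : Matrix (Fin s) (Fin s) ℂ}
    (hR : R.PosDef) (p q : Fin s → ℂ) :
    R.det * ∫ z : Fin s → ℂ, Complex.exp (-(star z ⬝ᵥ R *ᵥ z) + star z ⬝ᵥ p + q ⬝ᵥ z) =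
      (Real.pi : ℂ) ^ s * Complex.exp (q ⬝ᵥ R⁻¹ *ᵥ p) := by
  obtain ⟨M, rfl⟩ := CStarAlgebra.nonneg_iff_eq_star_mul_self.mp hR.posSemidef.nonneg
  rw [star_eq_conjTranspose] at *
  have hM : IsUnit M := isUnit_of_mul_isUnit_right hR.isUnit
  have hMdet : IsUnit M.det := (isUnit_iff_isUnit_det M).1 hM
  have hMHdet : IsUnit Mᴴ.det := by rw [det_conjTranspose]; exact hMdet.star
  let f (u : Fin s → ℂ) : ℂ :=
    Complex.exp (-(star u ⬝ᵥ u) + star u ⬝ᵥ (Mᴴ⁻¹ *ᵥ p) + (q ᵥ* M⁻¹) ⬝ᵥ u)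
  have h (z : Fin s → ℂ) :
      Complex.exp (-(star z ⬝ᵥ (Mᴴ * M) *ᵥ z) + star z ⬝ᵥ p + q ⬝ᵥ z) = f (M *ᵥ z) := by
    simp only [f, star_mulVec, ← dotProduct_mulVec, mulVec_mulVec, nonsing_inv_mul _ hMdet,
      mul_nonsing_inv _ hMHdet, one_mulVec]
  simp_rw [h]
  rw [det_mul, det_conjTranspose, mul_comm (star _), integral_comp_mulVec M hM,
    integral_cexp_neg_star_dotProduct_self_add, mul_inv_rev, ← mulVec_mulVec,
    ← dotProduct_mulVec]

/-- The Gaussian characteristic function identity from Lemma 2: for an `s × s`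
    Hermitian positive definite complex matrix `R`, an arbitrary complex matrix `K`,
    and `w ∈ ℂ^s`, with `B = (1/4)·[(I+K) R⁻¹ (I+K*) + (I−K) R (I−K*)]`,
    `det R · π^{−s} · ∫_{ℂ^s} exp(i·Im(z*(I+K*)w) − z* R z − Re(z* R (I+K*) w)
      − (1/2) w* R w − (1/2) w* K R K* w) dz = exp(−w* B w)`. -/
theorem gaussian_characteristic_function (s : ℕ) (hs : 0 < s)
    (R K : Matrix (Fin s) (Fin s) ℂ) (hR : R.PosDef) (w : Fin s → ℂ)
    (B : Matrix (Fin s) (Fin s) ℂ)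
    (hB : B = (1 / 4 : ℂ) •
      ((1 + K) * R⁻¹ * (1 + Kᴴ) + (1 - K) * R * (1 - Kᴴ))) :
    R.det * ((Real.pi : ℂ) ^ s)⁻¹ *
        ∫ z : Fin s → ℂ,
          Complex.exp (Complex.I * ((star z ⬝ᵥ (1 + Kᴴ).mulVec w).im : ℂ)
            - star z ⬝ᵥ R.mulVec z
            - ((star z ⬝ᵥ (R * (1 + Kᴴ)).mulVec w).re : ℂ)
            - (1 / 2 : ℂ) * (star w ⬝ᵥ R.mulVec w)
            - (1 / 2 : ℂ) * (star w ⬝ᵥ (K * R * Kᴴ).mulVec w)) =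
      Complex.exp (-(star w ⬝ᵥ B.mulVec w)) := by
  have hRH : Rᴴ = R := hR.1
  have hRdet : IsUnit R.det := (isUnit_iff_isUnit_det R).1 hR.isUnit
  set v := (1 + Kᴴ) *ᵥ w with hv
  have hexp (z : Fin s → ℂ) :
      Complex.I * ((star z ⬝ᵥ v).im : ℂ) - star z ⬝ᵥ R *ᵥ z
        - ((star z ⬝ᵥ (R * (1 + Kᴴ)) *ᵥ w).re : ℂ)
        - (1 / 2 : ℂ) * (star w ⬝ᵥ R *ᵥ w) - (1 / 2 : ℂ) * (star w ⬝ᵥ (K * R * Kᴴ) *ᵥ w) =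
      (-(star z ⬝ᵥ R *ᵥ z) + star z ⬝ᵥ ((1 / 2 : ℂ) • (v - R *ᵥ v)) +
        (-(1 / 2 : ℂ) • (star v + star v ᵥ* R)) ⬝ᵥ z) +
      (-(1 / 2 : ℂ) * (star w ⬝ᵥ R *ᵥ w) - (1 / 2 : ℂ) * (star w ⬝ᵥ (K * R * Kᴴ) *ᵥ w)) := by
    have hstar (x : Fin s → ℂ) : star (star z ⬝ᵥ x) = star x ⬝ᵥ z := by
      rw [← star_dotProduct_star, star_star]
    have him (x : ℂ) : Complex.I * (x.im : ℂ) = (x - star x) / 2 := by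
      rw [Complex.im_eq_sub_conj, RCLike.star_def]
      field_simp
    have hre (x : ℂ) : (x.re : ℂ) = (x + star x) / 2 := by
      rw [Complex.re_eq_add_conj, RCLike.star_def]
    rw [← mulVec_mulVec, ← hv, him, hre, hstar, hstar, star_mulVec R, hRH]
    simp only [dotProduct_smul, smul_dotProduct, dotProduct_sub, add_dotProduct, smul_eq_mul]
    ring
  have hpi : (Real.pi : ℂ) ^ s ≠ 0 := pow_ne_zero _ (by simp [Real.pi_ne_zero])
  simp_rw [hexp, Complex.exp_add _ (_ - _), integral_mul_const]
  rw [mul_right_comm, ← mul_assoc, hR.det_mul_integral_cexp, mul_right_comm,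
    mul_right_comm _ _ (_⁻¹), mul_inv_cancel₀ hpi, one_mul, ← Complex.exp_add]
  congr 1
  have hq : -(1 / 2 : ℂ) • (star v + star v ᵥ* R) =
      star w ᵥ* (-(1 / 2 : ℂ) • ((1 + K) * (1 + R))) := by
    rw [hv, star_mulVec, conjTranspose_add, conjTranspose_one, conjTranspose_conjTranspose,
      vecMul_smul, ← vecMul_vecMul, vecMul_add 1 R, vecMul_one]
  have hp : (1 / 2 : ℂ) • (v - R *ᵥ v) = ((1 / 2 : ℂ) • ((1 - R) * (1 + Kᴴ))) *ᵥ w := by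
    rw [smul_mulVec, ← mulVec_mulVec, ← hv, sub_mulVec, one_mulVec]
  have hRR : (1 + R) * R⁻¹ * (1 - R) = R⁻¹ - R := by
    rw [add_mul, one_mul, mul_nonsing_inv _ hRdet, add_mul, one_mul, mul_sub, mul_one,
      nonsing_inv_mul _ hRdet]
    abel
  have hprod : (1 + K) * (1 + R) * R⁻¹ * ((1 - R) * (1 + Kᴴ)) =
      (1 + K) * (R⁻¹ - R) * (1 + Kᴴ) := by
    rw [← hRR]
    simp only [mul_assoc]
  rw [hq, hp, hB, ← dotProduct_mulVec, mulVec_mulVec, mulVec_mulVec]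
  simp only [← smul_eq_mul (α := ℂ), ← dotProduct_smul, ← smul_mulVec, ← dotProduct_sub, ← sub_mulVec,
    ← dotProduct_add, ← add_mulVec, ← dotProduct_neg, ← neg_mulVec]
  congr 2
  rw [Matrix.mul_smul, Matrix.smul_mul, Matrix.smul_mul, hprod]
  simp only [add_mul, mul_add, sub_mul, mul_sub, one_mul, mul_one]
  module
end

section
/- Fix a real number N ≥ 0 and define, for E > 0 (with natural logarithm), g(x) = (x+1)·log(x+1) − x·log x (with g(0) = 0) and C_ea(E) = g(E) − g(N·E/(N+E+1)). Then C_ea(E)/(−E·log E) tends to 1/(N+1) as E tends to 0 from the right. -/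
open Real Filter

noncomputable def g (x : ℝ) : ℝ := (x + 1) * Real.log (x + 1) - x * Real.log x

noncomputable def Cea (N E : ℝ) : ℝ := g E - g (N * E / (N + E + 1))

open Topology in
lemma tendsto_log_one_add_mul_div {c : ℝ → ℝ} {c₀ : ℝ} (hc : Tendsto c (𝓝[>] 0) (𝓝 c₀))
    (hc_nonneg : ∀ᶠ x in 𝓝[>] 0, 0 ≤ c x) :
    Tendsto (fun x => log (c x * x + 1) / (-(x * log x))) (𝓝[>] 0) (𝓝 0) := by
  have h_bound : Tendsto (fun x => c x * (-log x)⁻¹) (𝓝[>] 0) (𝓝 0) := by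
    simpa using hc.mul (tendsto_neg_atBot_atTop.comp tendsto_log_nhdsGT_zero).inv_tendsto_atTop
  have h_lt : ∀ᶠ x : ℝ in 𝓝[>] 0, x < 1 :=
    nhdsWithin_le_nhds (Iio_mem_nhds one_pos)
  refine squeeze_zero' ?_ ?_ h_bound
  · filter_upwards [hc_nonneg, h_lt, self_mem_nhdsWithin] with x hcx hx1 (hx : 0 < x)
    have hlog := log_neg hx hx1
    exact div_nonneg (log_nonneg (by nlinarith [mul_nonneg hcx hx.le])) (by nlinarith)
  · filter_upwards [hc_nonneg, h_lt, self_mem_nhdsWithin] with x hcx hx1 (hx : 0 < x)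
    have hlog := log_neg hx hx1
    have hle : log (c x * x + 1) ≤ c x * x := by
      have := log_le_sub_one_of_pos (show 0 < c x * x + 1 by positivity)
      linarith
    calc log (c x * x + 1) / (-(x * log x)) ≤ c x * x / (-(x * log x)) :=
          div_le_div_of_nonneg_right hle (by nlinarith)
      _ = c x * (-log x)⁻¹ := by
          have := hlog.ne
          field_simp

open Topology in
lemma tendsto_g_mul_div {c : ℝ → ℝ} {c₀ : ℝ} (hc : Tendsto c (𝓝[>] 0) (𝓝 c₀))
    (hc_nonneg : ∀ᶠ x in 𝓝[>] 0, 0 ≤ c x) :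
    Tendsto (fun x => g (c x * x) / (-(x * log x))) (𝓝[>] 0) (𝓝 c₀) := by
  have h_id : Tendsto (fun x : ℝ => x) (𝓝[>] 0) (𝓝 0) := nhdsWithin_le_nhds
  have h_inv := (tendsto_neg_atBot_atTop.comp tendsto_log_nhdsGT_zero).inv_tendsto_atTop
  have h_entropy := ((continuous_negMulLog.tendsto c₀).comp hc).mul h_inv
  have h_sum := ((((hc.mul h_id).add_const 1).mul
    (tendsto_log_one_add_mul_div hc hc_nonneg)).add h_entropy).add hc
  simp only [mul_zero, zero_add] at h_sum
  refine h_sum.congr' ?_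
  filter_upwards [nhdsWithin_le_nhds (Iio_mem_nhds one_pos), self_mem_nhdsWithin]
    with x (hx1 : x < 1) (hx : 0 < x)
  have hlog := (log_neg hx hx1).ne
  have h_mul := negMulLog_mul (c x) x
  have hg : g (c x * x) = (c x * x + 1) * log (c x * x + 1)
      + (x * negMulLog (c x) + c x * negMulLog x) := by
    rw [← h_mul, g, negMulLog]
    ring
  rw [hg]
  simp only [Function.comp_apply, Pi.inv_apply, negMulLog]
  field_simp
  ring

/-- For measurement noise `N ≥ 0`, the entanglement-assisted capacity
    `C_ea(E) = g(E) − g(NE/(N+E+1))` satisfies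
    `C_ea(E)/(−E·log E) → 1/(N+1)` as `E → 0⁺`. -/
theorem Cea_asymptotics_at_zero (N : ℝ) (hN : 0 ≤ N) :
    Filter.Tendsto (fun E : ℝ => Cea N E / (-(E * Real.log E)))
      (nhdsWithin 0 (Set.Ioi 0)) (nhds (1 / (N + 1))) := by
  have h_one := tendsto_g_mul_div (c := fun _ => 1) tendsto_const_nhds
    (Eventually.of_forall fun _ => zero_le_one)
  have h_ratio : Tendsto (fun E : ℝ => N / (N + E + 1)) (nhdsWithin 0 (Set.Ioi 0))
      (nhds (N / (N + 1))) := by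
    have h_cont : ContinuousAt (fun E : ℝ => N / (N + E + 1)) 0 :=
      ContinuousAt.div (by fun_prop) (by fun_prop) (by positivity)
    simpa using h_cont.tendsto.mono_left nhdsWithin_le_nhds
  have h_noise := tendsto_g_mul_div h_ratio <| by
    filter_upwards [self_mem_nhdsWithin] with E (hE : 0 < E)
    positivity
  have h_lim : 1 / (N + 1) = 1 - N / (N + 1) := by
    field_simp
    ring
  rw [h_lim]
  refine (h_one.sub h_noise).congr fun E => ?_
  rw [Cea, one_mul, div_mul_eq_mul_div, sub_div]
end

section
/- Fix a real number N ≥ 0 and define, for E > 0 (with natural logarithm), g(x) = (x+1)·log(x+1) − x·log x (with g(0) = 0), C_ea(E) = g(E) − g(N·E/(N+E+1)) and C(E) = log(N+E+1) − log(N+1). Then the ratio (C_ea(E)/C(E))/(−log E) tends to 1 as E tends to 0 from the right; in particular the gain of entanglement assistance G(E) = C_ea(E)/C(E) behaves asymptotically as −log E in the weak-signal limit E → 0. -/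
open Real Filter

noncomputable def C (N E : ℝ) : ℝ := Real.log (N + E + 1) - Real.log (N + 1)

open Topology

theorem tendsto_div_of_hasDerivAt_zero {f : ℝ → ℝ} {f' : ℝ} (hf : HasDerivAt f f' 0)
    (h0 : f 0 = 0) : Tendsto (fun x => f x / x) (𝓝[>] 0) (𝓝 f') := by
  have h := (hasDerivAt_iff_tendsto_slope_zero.1 hf).mono_left
    (nhdsWithin_mono 0 fun x (hx : 0 < x) => hx.ne')
  refine h.congr fun x => ?_
  simp [h0, div_eq_inv_mul]

theorem tendsto_C_div (N : ℝ) (hN : 0 ≤ N) :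
    Tendsto (fun E => C N E / E) (𝓝[>] 0) (𝓝 (1 / (N + 1))) := by
  refine tendsto_div_of_hasDerivAt_zero ?_ (by simp [C])
  have h : HasDerivAt (fun E : ℝ => N + E + 1) 1 0 :=
    ((hasDerivAt_id 0).const_add N).add_const 1
  have h' := (h.log (by simp; positivity)).sub_const (Real.log (N + 1))
  rw [add_zero] at h'
  exact h'

theorem Cea_eq (N E : ℝ) (hE : E ≠ 0) :
    Cea N E = ((E + 1) * Real.log (E + 1)
        - (N * E / (N + E + 1) + 1) * Real.log (N * E / (N + E + 1) + 1))
      + E * (N / (N + E + 1) * Real.log (N / (N + E + 1)))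
      - E * ((1 - N / (N + E + 1)) * Real.log E) := by
  have hy : N * E / (N + E + 1) = N / (N + E + 1) * E := by ring
  rw [Cea, g, g, hy]
  rcases eq_or_ne (N / (N + E + 1)) 0 with hk | hk
  · simp [hk]
  · rw [Real.log_mul hk hE]; ring

theorem tendsto_Cea_div (N : ℝ) (hN : 0 ≤ N) :
    Tendsto (fun E => Cea N E / E / (-Real.log E)) (𝓝[>] 0) (𝓝 (1 / (N + 1))) := by
  have hN1 : N + 1 ≠ 0 := by positivity
  have hd : DifferentiableAt ℝ (fun E : ℝ => (E + 1) * Real.log (E + 1)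
      - (N * E / (N + E + 1) + 1) * Real.log (N * E / (N + E + 1) + 1)) 0 := by
    have hq : DifferentiableAt ℝ (fun E : ℝ => N * E / (N + E + 1) + 1) 0 :=
      (DifferentiableAt.div (by fun_prop) (by fun_prop) (by simpa using hN1)).add_const 1
    have hl : DifferentiableAt ℝ (fun E : ℝ => E + 1) 0 := by fun_prop
    exact (hl.mul (hl.log (by simp))).sub (hq.mul (hq.log (by simp)))
  have hu := tendsto_div_of_hasDerivAt_zero hd.hasDerivAt (by simp)
  have hk : Tendsto (fun E : ℝ => N / (N + E + 1)) (𝓝[>] 0) (𝓝 (N / (N + 1))) := by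
    have : ContinuousAt (fun E : ℝ => N / (N + E + 1)) 0 :=
      ContinuousAt.div (by fun_prop) (by fun_prop) (by simpa using hN1)
    simpa using this.tendsto.mono_left nhdsWithin_le_nhds
  have hklog := (Real.continuous_mul_log.tendsto (N / (N + 1))).comp hk
  have hinv : Tendsto (fun E => (-Real.log E)⁻¹) (𝓝[>] 0) (𝓝 0) :=
    (tendsto_neg_atBot_atTop.comp Real.tendsto_log_nhdsGT_zero).inv_tendsto_atTop
  have h := ((hu.add hklog).mul hinv).add (hk.const_sub 1)
  have hlim : 1 - N / (N + 1) = 1 / (N + 1) := by field_simp; ring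
  rw [mul_zero, zero_add, hlim] at h
  refine h.congr' ?_
  filter_upwards [Ioo_mem_nhdsGT (zero_lt_one' ℝ)] with E hE
  have hE0 : E ≠ 0 := hE.1.ne'
  have hlog : Real.log E ≠ 0 := (Real.log_neg hE.1 hE.2).ne
  rw [Cea_eq N E hE0]
  simp only [Function.comp_apply]
  generalize N / (N + E + 1) * Real.log (N / (N + E + 1)) = a
  generalize N / (N + E + 1) = k
  generalize (E + 1) * Real.log (E + 1) - _ = b
  field_simp
  ring

/-- For measurement noise `N ≥ 0`, the gain of entanglement assistance
    `G(E) = C_ea(E)/C(E)` satisfies `G(E)/(−log E) → 1` as `E → 0⁺`,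
    i.e. `G(E) ∼ −log E` in the weak-signal limit. -/
theorem gain_asymptotics_at_zero (N : ℝ) (hN : 0 ≤ N) :
    Filter.Tendsto (fun E : ℝ => (Cea N E / C N E) / (-Real.log E))
      (nhdsWithin 0 (Set.Ioi 0)) (nhds 1) := by
  have hN1 : 1 / (N + 1) ≠ 0 := by positivity
  have h := (tendsto_Cea_div N hN).div (tendsto_C_div N hN) hN1
  rw [div_self hN1] at h
  refine h.congr' ?_
  filter_upwards [self_mem_nhdsWithin] with E (hE : 0 < E)
  have hE0 : E ≠ 0 := hE.ne'
  simp only [Pi.div_apply]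
  rw [div_right_comm (Cea N E) E, div_div_div_cancel_right₀ hE0, div_right_comm]
end

section
/- Fix a real number N ≥ 0 and define, for E > 0 (with natural logarithm), g(x) = (x+1)·log(x+1) − x·log x (with g(0) = 0), C_ea(E) = g(E) − g(N·E/(N+E+1)) and C(E) = log(N+E+1) − log(N+1). Then the gain C_ea(E)/C(E) tends to +∞ as E tends to 0 from the right, i.e. the gain of entanglement assistance of the one-mode Gaussian measurement channel is unbounded in the weak-signal limit. -/
open Real Filter

lemma C_pos {N E : ℝ} (hN : 0 ≤ N) (hE : 0 < E) : 0 < C N E :=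
  sub_pos.2 (Real.log_lt_log (by linarith) (by linarith))

lemma C_le {N E : ℝ} (hN : 0 ≤ N) (hE : 0 < E) : C N E ≤ E := by
  have hN1 : 0 < N + 1 := by linarith
  unfold C
  rw [← Real.log_div (by linarith) hN1.ne']
  refine (Real.log_le_sub_one_of_pos (div_pos (by linarith) hN1)).trans ?_
  rw [sub_le_iff_le_add, div_le_iff₀ hN1]
  nlinarith [mul_nonneg hE.le hN]

lemma neg_one_le_mul_log {t : ℝ} (ht : 0 ≤ t) : -1 ≤ t * Real.log t := by
  rcases ht.eq_or_lt with rfl | ht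
  · simp
  · have h := mul_le_mul_of_nonneg_left (Real.one_sub_inv_le_log_of_pos ht) ht.le
    rw [mul_sub, mul_inv_cancel₀ ht.ne'] at h
    linarith

lemma mul_le_g_sub_g_mul {E t : ℝ} (hE : 0 < E) (ht : 0 ≤ t) (ht1 : t ≤ 1) :
    E * ((1 - t) * -Real.log E - 1) ≤ g E - g (E * t) := by
  have hy : 0 ≤ E * t := mul_nonneg hE.le ht
  have hyE : E * t ≤ E := mul_le_of_le_one_right hE.le ht1
  have hmono : (E * t + 1) * Real.log (E * t + 1) ≤ (E + 1) * Real.log (E + 1) :=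
    mul_le_mul (by linarith) (Real.log_le_log (by linarith) (by linarith))
      (Real.log_nonneg (by linarith)) (by linarith)
  have hlog : E * t * Real.log (E * t) = E * (t * Real.log E + t * Real.log t) := by
    rcases ht.eq_or_lt with rfl | ht
    · simp
    · rw [Real.log_mul hE.ne' ht.ne']
      ring
  have hent := mul_le_mul_of_nonneg_left (neg_one_le_mul_log ht) hE.le
  unfold g
  rw [hlog]
  linarith

lemma le_Cea {N E : ℝ} (hN : 0 ≤ N) (hE : 0 < E) (hE1 : E ≤ 1) :
    E * ((N + 1)⁻¹ * -Real.log E - 1) ≤ Cea N E := by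
  have hN1 : 0 < N + 1 := by linarith
  have hD : 0 < N + E + 1 := by linarith
  have ht : (N + 1)⁻¹ ≤ 1 - N / (N + E + 1) := by
    rw [one_sub_div hD.ne', inv_eq_one_div, div_le_div_iff₀ hN1 hD]
    nlinarith [mul_nonneg hE.le hN]
  have hlog : 0 ≤ -Real.log E := neg_nonneg.2 (Real.log_nonpos hE.le hE1)
  have h := mul_le_g_sub_g_mul hE (div_nonneg hN hD.le)
    ((div_le_one hD).2 (by linarith : N ≤ N + E + 1))
  rw [← mul_div_assoc, mul_comm E N] at h
  refine le_trans ?_ h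
  gcongr

/-- For measurement noise `N ≥ 0`, the gain of entanglement assistance
    `C_ea(E)/C(E)` tends to `+∞` as `E → 0⁺`. -/
theorem gain_unbounded_at_zero (N : ℝ) (hN : 0 ≤ N) :
    Filter.Tendsto (fun E : ℝ => Cea N E / C N E)
      (nhdsWithin 0 (Set.Ioi 0)) Filter.atTop := by
  have hN1 : 0 < (N + 1)⁻¹ := inv_pos.2 (by linarith)
  have hlim : Tendsto (fun E : ℝ => (N + 1)⁻¹ * -Real.log E - 1)
      (nhdsWithin 0 (Set.Ioi 0)) atTop :=
    tendsto_atTop_add_const_right _ (-1)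
      ((tendsto_neg_atBot_atTop.comp Real.tendsto_log_nhdsGT_zero).const_mul_atTop hN1)
  refine tendsto_atTop_mono' _ ?_ hlim
  filter_upwards [hlim.eventually_ge_atTop 0, self_mem_nhdsWithin,
    Ioo_mem_nhdsGT (zero_lt_one' ℝ)] with E hnonneg hE hE1
  rw [le_div_iff₀ (C_pos hN hE), mul_comm]
  exact (mul_le_mul_of_nonneg_right (C_le hN hE) hnonneg).trans (le_Cea hN hE hE1.2.le)
end

section
/- Fix a real number N ≥ 0 and define, for E > 0 (with natural logarithm), g(x) = (x+1)·log(x+1) − x·log x (with g(0) = 0), C_ea(E) = g(E) − g(N·E/(N+E+1)) and C(E) = log(N+E+1) − log(N+1). Then C_ea(E)/C(E) tends to 1 as E tends to +∞; equivalently, in the strong-signal limit both capacities are asymptotic to log E. -/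
open Real Filter

lemma continuous_g : Continuous g :=
  (Real.continuous_mul_log.comp (continuous_add_const 1)).sub Real.continuous_mul_log

lemma tendsto_div_add_add_one (N : ℝ) :
    Tendsto (fun E : ℝ => E / (N + E + 1)) atTop (nhds 1) := by
  have h : Tendsto (fun E : ℝ => 1 - (N + 1) / (E + (N + 1))) atTop (nhds (1 - 0)) :=
    tendsto_const_nhds.sub
      ((tendsto_atTop_add_const_right _ (N + 1) tendsto_id).const_div_atTop (N + 1))
  rw [sub_zero] at h
  refine h.congr' ?_
  filter_upwards [eventually_gt_atTop (-(N + 1))] with E hE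
  have h₁ : E + (N + 1) ≠ 0 := by linarith
  have h₂ : N + E + 1 ≠ 0 := by linarith
  field_simp
  ring

lemma g_eq_log_add {E : ℝ} (hE : 0 < E) :
    g E = log E + (E + 1) * log (1 + 1 / E) := by
  have h : E + 1 = E * (1 + 1 / E) := by field_simp
  have hlog : log (E + 1) = log E + log (1 + 1 / E) := by
    rw [← log_mul hE.ne' (by positivity), ← h]
  rw [g, hlog]
  ring

lemma tendsto_g_sub_log : Tendsto (fun E : ℝ => g E - log E) atTop (nhds 1) := by
  have h₁ : Tendsto (fun E : ℝ => log (1 + 1 / E)) atTop (nhds 0) := by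
    have h : Tendsto (fun E : ℝ => 1 + 1 / E) atTop (nhds (1 + 0)) :=
      tendsto_const_nhds.add (tendsto_id.const_div_atTop 1)
    simpa using h.log (by norm_num)
  have h₂ := (tendsto_mul_log_one_add_div_atTop 1).add h₁
  rw [add_zero] at h₂
  refine h₂.congr' ?_
  filter_upwards [eventually_gt_atTop 0] with E hE
  rw [g_eq_log_add hE]
  ring

lemma tendsto_C_atTop (N : ℝ) : Tendsto (C N) atTop atTop := by
  have h : Tendsto (fun E : ℝ => N + E + 1) atTop atTop :=
    tendsto_atTop_add_const_right _ 1 (tendsto_atTop_add_const_left _ N tendsto_id)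
  exact tendsto_atTop_add_const_right _ (-log (N + 1)) (tendsto_log_atTop.comp h)

lemma tendsto_Cea_sub_C {N : ℝ} (hN : 0 ≤ N) :
    Tendsto (fun E : ℝ => Cea N E - C N E) atTop (nhds (1 + log (N + 1) - g N)) := by
  have h₁ := tendsto_div_add_add_one N
  have h₂ : Tendsto (fun E : ℝ => log (E / (N + E + 1))) atTop (nhds 0) := by
    simpa using h₁.log one_ne_zero
  have h₃ : Tendsto (fun E : ℝ => g (N * (E / (N + E + 1)))) atTop (nhds (g N)) := by
    simpa [Function.comp_def] using (continuous_g.tendsto (N * 1)).comp (h₁.const_mul N)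
  have h := ((tendsto_g_sub_log.add h₂).add_const (log (N + 1))).sub h₃
  rw [add_zero] at h
  refine h.congr' ?_
  filter_upwards [eventually_gt_atTop 0] with E hE
  rw [Cea, C, log_div hE.ne' (by positivity), mul_div_assoc]
  ring

/-- For measurement noise `N ≥ 0`, the gain `C_ea(E)/C(E)` tends to `1`
    as `E → +∞` (strong-signal limit). -/
theorem gain_at_top (N : ℝ) (hN : 0 ≤ N) :
    Filter.Tendsto (fun E : ℝ => Cea N E / C N E) Filter.atTop (nhds 1) := by
  have h := ((tendsto_Cea_sub_C hN).div_atTop (tendsto_C_atTop N)).const_add 1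
  rw [add_zero] at h
  refine h.congr' ?_
  filter_upwards [(tendsto_C_atTop N).eventually_gt_atTop 0] with E hE
  have hC : C N E ≠ 0 := hE.ne'
  field_simp
  ring
end

section
/- Fix a real number N > 0 and define, for E > 0 (with natural logarithm), g(x) = (x+1)·log(x+1) − x·log x, C_ea(E) = g(E) − g(N·E/(N+E+1)) and C(E) = log(N+E+1) − log(N+1). Then the difference C_ea(E) − C(E) tends to 1 − N·log(1 + 1/N) as E tends to +∞. -/
open Real Filter

/-- The function `g` is continuous on the positive reals. -/
theorem continuousAt_g {x : ℝ} (hx : 0 < x) : ContinuousAt g x := by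
  have hx' : x + 1 ≠ 0 := by positivity
  unfold g
  fun_prop (disch := first | exact hx' | exact hx.ne')

theorem g_eq_mul_log_one_add_div {x : ℝ} (hx : 0 < x) :
    g x = x * Real.log (1 + 1 / x) + Real.log (x + 1) := by
  have h : 1 + 1 / x = (x + 1) / x := by field_simp
  rw [h, Real.log_div (by positivity) hx.ne', g]
  ring

theorem tendsto_mul_div_add_add_one_atTop (N : ℝ) :
    Tendsto (fun E : ℝ => N * E / (N + E + 1)) atTop (nhds N) := by
  have h0 : Tendsto (fun E : ℝ => N * (N + 1) / (N + E + 1)) atTop (nhds 0) :=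
    Tendsto.div_atTop tendsto_const_nhds
      (tendsto_atTop_add_const_right _ _ (tendsto_atTop_add_const_left _ _ tendsto_id))
  have h := (tendsto_const_nhds (x := N)).sub h0
  rw [sub_zero] at h
  refine h.congr' ?_
  filter_upwards [eventually_gt_atTop (-(N + 1))] with E hE
  have : N + E + 1 ≠ 0 := by linarith
  field_simp
  ring

/-- For measurement noise `N > 0`, the difference `C_ea(E) − C(E)` tends to
    `1 − N·log(1 + 1/N)` as `E → +∞`. -/
theorem capacity_difference_at_top (N : ℝ) (hN : 0 < N) :
    Filter.Tendsto (fun E : ℝ => Cea N E - C N E) Filter.atTop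
      (nhds (1 - N * Real.log (1 + 1 / N))) := by
  have hg : Tendsto (fun E : ℝ => g (N * E / (N + E + 1))) atTop (nhds (g N)) :=
    (continuousAt_g hN).tendsto.comp (tendsto_mul_div_add_add_one_atTop N)
  have hmul := Real.tendsto_mul_log_one_add_div_atTop 1
  have hlog := (Real.tendsto_log_comp_add_sub_log 1).sub
    (Real.tendsto_log_comp_add_sub_log (N + 1))
  have h := ((hmul.add hlog).sub hg).add_const (Real.log (N + 1))
  have hlim : 1 + (0 - 0) - g N + Real.log (N + 1) = 1 - N * Real.log (1 + 1 / N) := by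
    rw [g_eq_mul_log_one_add_div hN]
    ring
  rw [hlim] at h
  refine h.congr' ?_
  filter_upwards [eventually_gt_atTop 0] with E hE
  rw [Cea, C, g_eq_mul_log_one_add_div hE, show E + (N + 1) = N + E + 1 by ring]
  ring
end

section
/- Fix a real number E > 0 and define, for N > 0 (with natural logarithm), g(x) = (x+1)·log(x+1) − x·log x, C_ea(N) = g(E) − g(N·E/(N+E+1)) and C(N) = log(N+E+1) − log(N+1). Then the gain C_ea(N)/C(N) tends to (E+1)·log((E+1)/E) as N tends to +∞. -/
open Real Filter

theorem hasDerivAt_g {x : ℝ} (hx : 0 < x) : HasDerivAt g (Real.log ((x + 1) / x)) x := by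
  have hx1 : x + 1 ≠ 0 := by positivity
  have h := ((Real.hasDerivAt_mul_log hx1).comp_add_const x 1).sub
    (Real.hasDerivAt_mul_log hx.ne')
  rw [Real.log_div hx1 hx.ne']
  exact h.congr_deriv (by ring)

theorem hasDerivAt_g_attenuated {E : ℝ} (hE : 0 < E) :
    HasDerivAt (fun t : ℝ => g ((1 - t) * E / (1 + E * t)))
      (-(E * ((E + 1) * Real.log ((E + 1) / E)))) 0 := by
  have hnum : HasDerivAt (fun t : ℝ => (1 - t) * E) (-1 * E) 0 :=
    ((hasDerivAt_id (0 : ℝ)).const_sub 1).mul_const E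
  have hden : HasDerivAt (fun t : ℝ => 1 + E * t) (E * 1) 0 :=
    ((hasDerivAt_id (0 : ℝ)).const_mul E).const_add 1
  have hquot := hnum.div hden (by simp)
  have hg : HasDerivAt g (Real.log ((E + 1) / E)) ((1 - 0) * E / (1 + E * 0)) := by
    simpa using hasDerivAt_g hE
  refine (hg.comp (0 : ℝ) hquot).congr_deriv ?_
  simp only [mul_zero, add_zero, sub_zero, one_mul]
  ring

theorem hasDerivAt_log_one_add_mul (E : ℝ) :
    HasDerivAt (fun t : ℝ => Real.log (1 + E * t)) E 0 := by
  have hlin : HasDerivAt (fun t : ℝ => 1 + E * t) (E * 1) 0 :=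
    ((hasDerivAt_id (0 : ℝ)).const_mul E).const_add 1
  simpa using hlin.log (by simp)

/-- For fixed input energy `E > 0`, the gain `C_ea(N)/C(N)` tends to
    `(E+1)·log((E+1)/E)` as the measurement noise `N → +∞`. -/
theorem gain_weak_noise_limit (E : ℝ) (hE : 0 < E) :
    Filter.Tendsto (fun N : ℝ => Cea N E / C N E) Filter.atTop
      (nhds ((E + 1) * Real.log ((E + 1) / E))) := by
  have hinv : Tendsto (fun N : ℝ => (N + 1)⁻¹) atTop (nhdsWithin 0 {0}ᶜ) := by
    refine tendsto_nhdsWithin_iff.2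
      ⟨tendsto_inv_atTop_zero.comp (tendsto_atTop_add_const_right _ 1 tendsto_id), ?_⟩
    filter_upwards [eventually_gt_atTop (0 : ℝ)] with N hN
    have : (N + 1)⁻¹ ≠ 0 := by positivity
    simpa using this
  have hCea := (hasDerivAt_iff_tendsto_slope.1 (hasDerivAt_g_attenuated hE)).neg
  have hC := hasDerivAt_iff_tendsto_slope.1 (hasDerivAt_log_one_add_mul E)
  have h := (hCea.div hC hE.ne').comp hinv
  rw [neg_neg, mul_div_cancel_left₀ _ hE.ne'] at h
  refine h.congr' ?_
  filter_upwards [eventually_gt_atTop (0 : ℝ)] with N hN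
  have hN1 : N + 1 ≠ 0 := by positivity
  have hNE : N + E + 1 ≠ 0 := by positivity
  have hden : 1 + E * (N + 1)⁻¹ = (N + E + 1) / (N + 1) := by
    field_simp
    ring
  have hmean : (1 - (N + 1)⁻¹) * E / (1 + E * (N + 1)⁻¹) = N * E / (N + E + 1) := by
    rw [hden]
    field_simp
    ring
  simp only [Function.comp_apply, Pi.div_apply, slope_def_field, hmean, Cea, C]
  rw [hden, Real.log_div hNE hN1]
  simp only [mul_zero, add_zero, sub_zero, one_mul, div_one, Real.log_one]
  rw [← neg_div, neg_sub, div_div_div_cancel_right₀ (inv_ne_zero hN1)]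
end
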